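/- Let (m_n)_{n≥1} be a bounded sequence of integers with m_n ≥ 2, set μ_n = log m_n and t_n = (3·log n)/(2·μ_n). Then t_n → ∞; the family of m_n-shuffles presents a (t_n, 1) total variation cutoff, i.e. lim_{c→+∞} limsup_{n→∞} ‖Q_{n,m_n}^{⌈t_n + c⌉} − U_n‖_TV = 0 and lim_{c→+∞} liminf_{n→∞} ‖Q_{n,m_n}^{max(⌊t_n − c⌋,0)} − U_n‖_TV = 1; and for every fixed integer k, 0 < liminf_{n→∞} ‖Q_{n,m_n}^{{t_n}+k} − U_n‖_TV ≤ limsup_{n→∞} ‖Q_{n,m_n}^{{t_n}+k} − U_n‖_TV < 1 (where {t_n} + k ≥ 0 for all n large enough). -/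

import Mathlib

open Filter MeasureTheory
open scoped BigOperators NNReal ENNReal

noncomputable section

/-- The value of `σ⁻¹` at position `i` (0-indexed), as a natural number; `0` out of range. -/
def invAt (n : ℕ) (σ : Equiv.Perm (Fin n)) (i : ℕ) : ℕ :=
  if h : i < n then ((σ⁻¹ ⟨i, h⟩ : Fin n) : ℕ) else 0

/-- The number of rising sequences of a permutation: one plus the number of descents
of its inverse. -/
def rSeq (n : ℕ) (σ : Equiv.Perm (Fin n)) : ℕ :=
  1 + ((Finset.range (n - 1)).filter fun i => invAt n σ (i + 1) < invAt n σ i).card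

/-- The `m`-shuffle distribution on `S_n`:  `Q_{n,m}(σ) = m^{-n} C(n + m - r(σ), n)`. -/
def Qs (n m : ℕ) (σ : Equiv.Perm (Fin n)) : ℝ :=
  ((m : ℝ) ^ n)⁻¹ * (Nat.choose (n + m - rSeq n σ) n : ℝ)

/-- The uniform distribution on `S_n`. -/
def Us (n : ℕ) (_ : Equiv.Perm (Fin n)) : ℝ := (n.factorial : ℝ)⁻¹

/-- Total variation distance between two probability distributions on `S_n`. -/
def tv (n : ℕ) (μ ν : Equiv.Perm (Fin n) → ℝ) : ℝ :=
  (1 / 2) * ∑ σ : Equiv.Perm (Fin n), |μ σ - ν σ|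

/-- Convolution of two distributions on `S_n`. -/
def convol (n : ℕ) (μ ν : Equiv.Perm (Fin n) → ℝ) : Equiv.Perm (Fin n) → ℝ :=
  fun σ => ∑ τ : Equiv.Perm (Fin n), μ (σ * τ⁻¹) * ν τ

/-- `k`-fold convolution power; the `0`-th power is the point mass at the identity. -/
def iterConv (n : ℕ) (μ : Equiv.Perm (Fin n) → ℝ) : ℕ → Equiv.Perm (Fin n) → ℝ
  | 0 => fun σ => if σ = 1 then 1 else 0
  | k + 1 => convol n μ (iterConv n μ k)

/-- `Ψ(x) = (2π)^{-1/2} ∫_{-x/(4√3)}^{x/(4√3)} e^{-t²/2} dt`. -/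
def Psi (x : ℝ) : ℝ :=
  (Real.sqrt (2 * Real.pi))⁻¹ *
    ∫ t in (-(x / (4 * Real.sqrt 3)))..(x / (4 * Real.sqrt 3)), Real.exp (-t ^ 2 / 2)

/-- The `p`-shuffle distribution on `S_n` for a probability `p` on the positive integers. -/
def Qp (n : ℕ) (p : ℕ → ℝ) (σ : Equiv.Perm (Fin n)) : ℝ := ∑' m : ℕ, p m * Qs n m σ

/-- `{t}`: the nearest integer to `t` (rounding half up), except `{t} = 1/2` for `0 < t < 1/2`. -/
def curly (t : ℝ) : ℝ := if t < 1 / 2 then 1 / 2 else ((round t : ℤ) : ℝ)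

/-- `d(t) = 1/2` for `0 < t < 1/2` and `d(t) = t - {t}` for `t ≥ 1/2`. -/
def dOf (t : ℝ) : ℝ := if t < 1 / 2 then 1 / 2 else t - ((round t : ℤ) : ℝ)

lemma perm_inv_apply_self {α : Type*} (σ : Equiv.Perm α) (x : α) : σ⁻¹ (σ x) = x :=
  σ.symm_apply_apply x

/-- The number of descents of `τ` among the first `i` adjacent pairs. -/
def desCount {n : ℕ} (τ : Equiv.Perm (Fin n)) (i : ℕ) : ℕ :=
  ((Finset.range i).filter fun j => invAt n τ⁻¹ (j + 1) < invAt n τ⁻¹ j).card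

lemma desCount_succ {n : ℕ} (τ : Equiv.Perm (Fin n)) (i : ℕ) :
    desCount τ (i + 1) =
      desCount τ i + if invAt n τ⁻¹ (i + 1) < invAt n τ⁻¹ i then 1 else 0 := by
  unfold desCount
  rw [Finset.range_add_one, Finset.filter_insert]
  split_ifs <;> simp

lemma desCount_le {n : ℕ} (τ : Equiv.Perm (Fin n)) (i : ℕ) : desCount τ i ≤ i :=
  (Finset.card_filter_le _ _).trans (by simp)

lemma desCount_add_le {n : ℕ} (τ : Equiv.Perm (Fin n)) (i j : ℕ) :
    desCount τ (i + j) ≤ desCount τ i + j := by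
  induction j with
  | zero => simp
  | succ j ih => rw [← add_assoc, desCount_succ]; split_ifs <;> omega

lemma desCount_mono {n : ℕ} (τ : Equiv.Perm (Fin n)) : Monotone (desCount τ) :=
  monotone_nat_of_le_succ fun i => by rw [desCount_succ]; omega

lemma rSeq_eq_desCount {n : ℕ} (σ : Equiv.Perm (Fin n)) : rSeq n σ = 1 + desCount σ⁻¹ (n - 1) := by
  simp [rSeq, desCount]

lemma eq_sort_iff_gap {n m : ℕ} (f : Fin (n + 1) → Fin m) (τ : Equiv.Perm (Fin (n + 1))) :
    τ = Tuple.sort f ↔ ∀ i : Fin n, (f (τ i.castSucc) : ℕ) + desCount τ (i + 1) ≤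
      f (τ i.succ) + desCount τ i := by
  have key : τ = Tuple.sort f ↔
      StrictMono (fun i => (toLex (f (τ i), τ i) : Lex (Fin m × Fin (n + 1)))) := by
    rw [Tuple.eq_sort_iff']
    rfl
  rw [key, Fin.strictMono_iff_lt_succ]
  refine forall_congr' fun i => ?_
  rw [Prod.Lex.toLex_lt_toLex, desCount_succ]
  have h1 : invAt (n + 1) τ⁻¹ (i + 1) = τ i.succ := by
    simp [invAt, Fin.succ]
  have h2 : invAt (n + 1) τ⁻¹ i = τ i.castSucc := by
    simp only [invAt, inv_inv]
    rw [dif_pos (by omega)]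
    rfl
  have h3 : τ i.castSucc ≠ τ i.succ := by
    intro h
    have := τ.injective h
    simp [Fin.ext_iff] at this
  rw [h1, h2]
  simp only [Fin.lt_def, Fin.ext_iff, ne_eq] at *
  split_ifs <;> omega

lemma add_le_of_orderEmb {n k : ℕ} (e : Fin n ↪o Fin k) (i d : ℕ) (h : i + d < n) :
    (e ⟨i, by omega⟩ : ℕ) + d ≤ e ⟨i + d, h⟩ := by
  induction d with
  | zero => simp
  | succ d ih =>
    have h1 := ih (by omega)
    have h2 : e ⟨i + d, by omega⟩ < e ⟨i + (d + 1), h⟩ := e.strictMono (by simp [Fin.lt_def])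
    rw [Fin.lt_def] at h2
    omega

lemma le_orderEmb_apply {n k : ℕ} (e : Fin n ↪o Fin k) (i : Fin n) : (i : ℕ) ≤ e i := by
  have h := add_le_of_orderEmb e 0 i (by have := i.2; omega)
  simp only [zero_add, Fin.eta] at h
  omega

lemma orderEmb_apply_add_lt {n k : ℕ} (e : Fin (n + 1) ↪o Fin k) (i : Fin (n + 1)) :
    (e i : ℕ) + (n - i) < k := by
  have h := add_le_of_orderEmb e i (n - i) (by have := i.2; omega)
  exact lt_of_le_of_lt h (Fin.is_lt _)

/-- Functions whose stable sort is `τ` correspond to strictly increasing sequences. -/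
def sortFiberEquiv {n m : ℕ} (τ : Equiv.Perm (Fin (n + 1))) :
    {f : Fin (n + 1) → Fin m // τ = Tuple.sort f} ≃
      (Fin (n + 1) ↪o Fin (m + n - desCount τ n)) where
  toFun f := OrderEmbedding.ofStrictMono
    (fun i => ⟨f.1 (τ i) + (i - desCount τ i), by
      have h1 := (f.1 (τ i)).2
      have h2 := desCount_add_le τ i (n - i)
      have h3 := desCount_le τ i
      have h4 := i.2
      rw [show (i : ℕ) + (n - i) = n by omega] at h2
      omega⟩) (by
      rw [Fin.strictMono_iff_lt_succ]
      intro i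
      have h := (eq_sort_iff_gap f.1 τ).1 f.2 i
      have h3 := desCount_le τ i
      have h4 := desCount_le τ (i + 1)
      have h5 := desCount_add_le τ i 1
      simp only [Fin.lt_def, Fin.val_castSucc, Fin.val_succ]
      omega)
  invFun e := ⟨fun j => ⟨e (τ⁻¹ j) - (τ⁻¹ j - desCount τ (τ⁻¹ j)), by
      have h1 := orderEmb_apply_add_lt e (τ⁻¹ j)
      have h2 := le_orderEmb_apply e (τ⁻¹ j)
      have h3 := (τ⁻¹ j).2
      have h4 := desCount_mono τ (Nat.le_of_lt_succ h3)
      have h5 := desCount_le τ (τ⁻¹ j)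
      omega⟩, by
      rw [eq_sort_iff_gap]
      intro i
      have h1 := le_orderEmb_apply e i.castSucc
      have h2 := le_orderEmb_apply e i.succ
      have h3 : e i.castSucc < e i.succ := e.strictMono Fin.castSucc_lt_succ
      have h5 := desCount_le τ i
      have h6 := desCount_le τ (i + 1)
      simp only [Fin.lt_def, Fin.val_castSucc, Fin.val_succ, perm_inv_apply_self] at *
      omega⟩
  left_inv f := by
    ext j
    simp
  right_inv e := by
    ext j
    have h2 := le_orderEmb_apply e j
    simp only [OrderEmbedding.coe_ofStrictMono, perm_inv_apply_self]
    omega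

lemma card_sort_fiber (n m : ℕ) (σ : Equiv.Perm (Fin n)) :
    Nat.card {f : Fin n → Fin m // σ⁻¹ = Tuple.sort f} = (n + m - rSeq n σ).choose n := by
  cases n with
  | zero =>
    have : ∀ f : Fin 0 → Fin m, σ⁻¹ = Tuple.sort f := fun f => Subsingleton.elim _ _
    have e : {f : Fin 0 → Fin m // σ⁻¹ = Tuple.sort f} ≃ (Fin 0 → Fin m) :=
      Equiv.subtypeUnivEquiv this
    rw [Nat.card_congr e]
    simp
  | succ n =>
    rw [Nat.card_congr ((sortFiberEquiv σ⁻¹).trans Set.powersetCard.ofFinEmbEquiv),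
      Set.powersetCard.card, Nat.card_fin, rSeq_eq_desCount]
    congr 1
    simp only [Nat.add_sub_cancel]
    omega

/-- The uniform measure of functions into `Fin m` pushed forward by the inverse stable sort is
the `m`-shuffle. -/
lemma Qs_eq_sum (n m : ℕ) (σ : Equiv.Perm (Fin n)) :
    Qs n m σ = ((m : ℝ) ^ n)⁻¹ *
      ∑ f : Fin n → Fin m, if (Tuple.sort f)⁻¹ = σ then 1 else 0 := by
  rw [Qs, ← card_sort_fiber n m σ, Nat.card_eq_fintype_card, Fintype.card_subtype,
    Finset.sum_boole]
  congr 3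
  ext f
  simp only [Finset.mem_filter, Finset.mem_univ, true_and]
  rw [eq_comm, ← inv_eq_iff_eq_inv]

lemma Qs_nonneg (n m : ℕ) (σ : Equiv.Perm (Fin n)) : 0 ≤ Qs n m σ := by
  unfold Qs; positivity

lemma sum_Qs (n m : ℕ) (hm : 0 < m) : ∑ σ : Equiv.Perm (Fin n), Qs n m σ = 1 := by
  simp_rw [Qs_eq_sum n m]
  rw [← Finset.mul_sum, Finset.sum_comm]
  simp only [Finset.sum_ite_eq, Finset.mem_univ, if_true, Finset.sum_const, Finset.card_univ,
    Fintype.card_fun, Fintype.card_fin, nsmul_eq_mul, mul_one, Nat.cast_pow]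
  have : (m : ℝ) ≠ 0 := by positivity
  field_simp

/-- Radix sort: a lexicographic stable sort is a stable sort by the low digit followed by a
stable sort by the high digit. -/
lemma sort_radix {n a b : ℕ} (f : Fin n → Fin a) (g : Fin n → Fin b) :
    Tuple.sort g * Tuple.sort f =
      Tuple.sort (fun i => finProdFinEquiv (f ((Tuple.sort g)⁻¹ i), g i)) := by
  obtain ⟨hf1, hf2⟩ := Tuple.eq_sort_iff.1 (rfl : Tuple.sort f = Tuple.sort f)
  obtain ⟨hg1, hg2⟩ := Tuple.eq_sort_iff.1 (rfl : Tuple.sort g = Tuple.sort g)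
  generalize Tuple.sort f = α at *
  generalize Tuple.sort g = β at *
  rw [Tuple.eq_sort_iff]
  refine ⟨fun i j hij => ?_, fun i j hij h => ?_⟩
  · simp only [Function.comp, Equiv.Perm.mul_apply, perm_inv_apply_self, Fin.le_def,
      finProdFinEquiv_apply_val]
    rcases hij.eq_or_lt with rfl | hij'
    · rfl
    rcases (hf1 hij).eq_or_lt with h | h
    · have h3 := hg1 (hf2 i j hij' h).le
      simp only [Function.comp, Fin.le_def] at h h3
      rw [h]
      omega
    · simp only [Function.comp, Fin.lt_def] at h
      have h1 := (g (β (α i))).2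
      calc (g (β (α i)) : ℕ) + b * f (α i) ≤ b * (f (α i) + 1) := by rw [mul_add]; omega
        _ ≤ b * f (α j) := Nat.mul_le_mul_left _ h
        _ ≤ _ := Nat.le_add_left _ _
  · simp only [Equiv.Perm.mul_apply, perm_inv_apply_self, EmbeddingLike.apply_eq_iff_eq,
      Prod.mk.injEq] at h ⊢
    exact hg2 _ _ (hf2 i j hij h.1) h.2

lemma convol_Qs (n a b : ℕ) :
    convol n (Qs n a) (Qs n b) = Qs n (a * b) := by
  ext σ
  have e1 : convol n (Qs n a) (Qs n b) σ = ((a : ℝ) ^ n)⁻¹ * ((b : ℝ) ^ n)⁻¹ *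
      ∑ g : Fin n → Fin b, ∑ f : Fin n → Fin a,
        if (Tuple.sort g * Tuple.sort f)⁻¹ = σ then 1 else 0 := by
    unfold convol
    simp_rw [Qs_eq_sum n a, Qs_eq_sum n b]
    simp_rw [mul_mul_mul_comm, ← Finset.mul_sum]
    congr 1
    simp_rw [Finset.mul_sum]
    rw [Finset.sum_comm]
    refine Finset.sum_congr rfl fun g _ => ?_
    simp only [mul_ite, mul_one, mul_zero, Finset.sum_ite_eq, Finset.mem_univ, if_true, inv_inv]
    refine Finset.sum_congr rfl fun f _ => ?_
    simp only [mul_inv_rev, ← eq_mul_inv_iff_mul_eq, inv_inv]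
  have e2 : ∀ g : Fin n → Fin b, (∑ f : Fin n → Fin a,
        if (Tuple.sort g * Tuple.sort f)⁻¹ = σ then (1 : ℝ) else 0) =
      ∑ f : Fin n → Fin a,
        if (Tuple.sort fun i => finProdFinEquiv (f i, g i))⁻¹ = σ then (1 : ℝ) else 0 := by
    intro g
    rw [eq_comm, ← Equiv.sum_comp ((Tuple.sort g).arrowCongr (Equiv.refl (Fin a)))]
    refine (Finset.sum_congr rfl fun f _ => ?_).symm
    rw [sort_radix]
    rfl
  rw [e1, Qs_eq_sum n (a * b)]
  simp_rw [e2]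
  rw [Nat.cast_mul, mul_pow, mul_inv, Finset.sum_comm]
  congr 1
  rw [← Fintype.sum_prod_type' (f := fun (f : Fin n → Fin a) (g : Fin n → Fin b) =>
    if (Tuple.sort fun i => finProdFinEquiv (f i, g i))⁻¹ = σ then (1 : ℝ) else 0)]
  exact Fintype.sum_equiv ((Equiv.arrowProdEquivProdArrow (Fin n) (fun _ => Fin a)
    (fun _ => Fin b)).symm.trans ((Equiv.refl _).arrowCongr finProdFinEquiv)) _ _ fun x => rfl

lemma iterConv_Qs (n m : ℕ) (k : ℕ) : iterConv n (Qs n m) k = Qs n (m ^ k) := by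
  induction k with
  | zero =>
    ext σ
    rw [pow_zero, Qs_eq_sum n 1]
    have : ∀ f : Fin n → Fin 1, Tuple.sort f = 1 := fun f =>
      Tuple.sort_eq_refl_iff_monotone.2 (fun _ _ _ => (Subsingleton.elim _ _).le)
    simp [iterConv, this, eq_comm]
  | succ k ih => rw [iterConv, ih, convol_Qs n m, pow_succ']

/-- The centred indicator of an inverse descent at `i`. -/
def desDev (n : ℕ) (σ : Equiv.Perm (Fin n)) (i : ℕ) : ℝ :=
  (if invAt n σ (i + 1) < invAt n σ i then 1 else 0) - 1 / 2

lemma abs_desDev (n : ℕ) (σ : Equiv.Perm (Fin n)) (i : ℕ) : |desDev n σ i| = 1 / 2 := by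
  unfold desDev
  split_ifs <;> norm_num

/-- Exchanging the values at `i` and `i + 1` flips the descent at `i` and preserves the descents
that are not adjacent to it. -/
lemma exists_mul_desDev_neg (n i : ℕ) (hi : i + 1 < n) : ∃ s : Equiv.Perm (Fin n),
    (∀ σ, desDev n (s * σ) i = -desDev n σ i) ∧
    ∀ σ j, j ≠ i → j + 1 ≠ i → j ≠ i + 1 → desDev n (s * σ) j = desDev n σ j := by
  let a : Fin n := ⟨i, by omega⟩
  let b : Fin n := ⟨i + 1, hi⟩
  have hab : a ≠ b := by simp [a, b]
  have hs : ∀ σ : Equiv.Perm (Fin n), ∀ x : Fin n,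
      (Equiv.swap a b * σ)⁻¹ x = σ⁻¹ (Equiv.swap a b x) := by
    intro σ x
    rw [mul_inv_rev, Equiv.swap_inv, Equiv.Perm.mul_apply]
  have h1 : ∀ σ, invAt n (Equiv.swap a b * σ) i = invAt n σ (i + 1) := by
    intro σ
    rw [invAt, invAt, dif_pos (by omega), dif_pos hi, hs]
    change ((σ⁻¹ (Equiv.swap a b a) : Fin n) : ℕ) = _
    rw [Equiv.swap_apply_left]
  have h2 : ∀ σ, invAt n (Equiv.swap a b * σ) (i + 1) = invAt n σ i := by
    intro σ
    rw [invAt, invAt, dif_pos hi, dif_pos (by omega), hs]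
    change ((σ⁻¹ (Equiv.swap a b b) : Fin n) : ℕ) = _
    rw [Equiv.swap_apply_right]
  have h3 : ∀ σ j, j ≠ i → j ≠ i + 1 → invAt n (Equiv.swap a b * σ) j = invAt n σ j := by
    intro σ j hj hj'
    unfold invAt
    split_ifs with h
    · rw [hs, Equiv.swap_apply_of_ne_of_ne] <;> simpa [a, b, Fin.ext_iff]
    · rfl
  refine ⟨Equiv.swap a b, fun σ => ?_, fun σ j hj hj1 hj2 => ?_⟩
  · unfold desDev
    rw [h1, h2]
    have h4 : invAt n σ i ≠ invAt n σ (i + 1) := by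
      rw [invAt, invAt, dif_pos (by omega), dif_pos hi]
      intro h
      exact hab (σ⁻¹.injective (Fin.ext h))
    split_ifs <;> first | omega | norm_num
  · unfold desDev
    rw [h3 σ j hj hj2, h3 σ (j + 1) hj1 (by omega)]

lemma sum_desDev (n i : ℕ) (hi : i + 1 < n) : ∑ σ, desDev n σ i = 0 := by
  obtain ⟨s, h1, -⟩ := exists_mul_desDev_neg n i hi
  have h := Equiv.sum_comp (Equiv.mulLeft s) fun σ => desDev n σ i
  simp only [Equiv.coe_mulLeft, h1, Finset.sum_neg_distrib] at h
  linarith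

lemma sum_desDev_mul (n i j : ℕ) (hi : i + 1 < n) (h1 : j ≠ i) (h2 : j + 1 ≠ i)
    (h3 : j ≠ i + 1) : ∑ σ, desDev n σ i * desDev n σ j = 0 := by
  obtain ⟨s, hs, hs'⟩ := exists_mul_desDev_neg n i hi
  have h := Equiv.sum_comp (Equiv.mulLeft s) fun σ => desDev n σ i * desDev n σ j
  simp only [Equiv.coe_mulLeft, hs, hs' _ j h1 h2 h3, neg_mul, Finset.sum_neg_distrib] at h
  linarith

lemma sum_desDev_mul_le (n i j : ℕ) :
    ∑ σ, desDev n σ i * desDev n σ j ≤ n.factorial * (1 / 4) := by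
  have h : ∀ σ ∈ (Finset.univ : Finset (Equiv.Perm (Fin n))),
      desDev n σ i * desDev n σ j ≤ 1 / 4 := by
    intro σ _
    refine (le_abs_self _).trans ?_
    rw [abs_mul, abs_desDev, abs_desDev]
    norm_num
  refine (Finset.sum_le_card_nsmul _ _ _ h).trans ?_
  simp [Fintype.card_perm]

lemma rSeq_eq_sum_desDev (n : ℕ) (hn : 1 ≤ n) (σ : Equiv.Perm (Fin n)) :
    (rSeq n σ : ℝ) - (n + 1) / 2 = ∑ i ∈ Finset.range (n - 1), desDev n σ i := by
  unfold rSeq desDev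
  rw [Finset.sum_sub_distrib, Finset.sum_boole]
  simp [Nat.cast_sub hn]
  ring

lemma sum_rSeq_dev (n : ℕ) (hn : 1 ≤ n) :
    ∑ σ : Equiv.Perm (Fin n), ((rSeq n σ : ℝ) - (n + 1) / 2) = 0 := by
  simp_rw [rSeq_eq_sum_desDev n hn]
  rw [Finset.sum_comm]
  refine Finset.sum_eq_zero fun i hi => sum_desDev n i ?_
  have := Finset.mem_range.1 hi
  omega

lemma sum_rSeq_dev_sq_le (n : ℕ) (hn : 1 ≤ n) :
    ∑ σ : Equiv.Perm (Fin n), ((rSeq n σ : ℝ) - (n + 1) / 2) ^ 2 ≤ (n : ℝ) * n.factorial := by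
  simp_rw [rSeq_eq_sum_desDev n hn, sq, Finset.sum_mul_sum]
  rw [Finset.sum_comm]
  have key : ∀ i ∈ Finset.range (n - 1),
      ∑ σ, ∑ j ∈ Finset.range (n - 1), desDev n σ i * desDev n σ j ≤ (n.factorial : ℝ) := by
    intro i hi
    have hi' := Finset.mem_range.1 hi
    rw [Finset.sum_comm]
    calc ∑ j ∈ Finset.range (n - 1), ∑ σ, desDev n σ i * desDev n σ j
        ≤ ∑ j ∈ Finset.range (n - 1),
          if j ∈ ({i - 1, i, i + 1} : Finset ℕ) then (n.factorial : ℝ) * (1 / 4) else 0 := by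
          refine Finset.sum_le_sum fun j _ => ?_
          split_ifs with h
          · exact sum_desDev_mul_le n i j
          · simp only [Finset.mem_insert, Finset.mem_singleton, not_or] at h
            exact (sum_desDev_mul n i j (by omega) (by omega) (by omega) (by omega)).le
      _ = ((Finset.range (n - 1)).filter (· ∈ ({i - 1, i, i + 1} : Finset ℕ))).card *
          ((n.factorial : ℝ) * (1 / 4)) := by
          rw [← Finset.sum_filter, Finset.sum_const, nsmul_eq_mul]
      _ ≤ 3 * ((n.factorial : ℝ) * (1 / 4)) := by
          refine mul_le_mul_of_nonneg_right ?_ (by positivity)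
          have h1 : ((Finset.range (n - 1)).filter (· ∈ ({i - 1, i, i + 1} : Finset ℕ))).card ≤
              ({i - 1, i, i + 1} : Finset ℕ).card :=
            Finset.card_le_card fun j hj => (Finset.mem_filter.1 hj).2
          exact_mod_cast h1.trans Finset.card_le_three
      _ ≤ n.factorial := by
          have : (0 : ℝ) ≤ n.factorial := by positivity
          linarith
  refine (Finset.sum_le_card_nsmul _ _ _ key).trans ?_
  rw [Finset.card_range, nsmul_eq_mul]
  gcongr
  omega

/-- Cantelli's one-sided inequality for the uniform distribution on a finite type. -/
lemma cantelli {Ω : Type*} [Fintype Ω] (X : Ω → ℝ) (V s : ℝ) (hV : 0 < V) (hs : 0 < s)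
    (h1 : ∑ ω, X ω = 0) (h2 : ∑ ω, X ω ^ 2 ≤ V * Fintype.card Ω) :
    s ^ 2 / (V + s ^ 2) * Fintype.card Ω ≤ ((Finset.univ.filter fun ω => X ω ≤ s).card : ℝ) := by
  set G := Finset.univ.filter fun ω => X ω ≤ s
  set N : ℝ := (Fintype.card Ω : ℝ)
  set b : ℝ := ((Finset.univ.filter fun ω => ¬ X ω ≤ s).card : ℝ)
  have hb : (G.card : ℝ) + b = N := by
    have := Finset.card_filter_add_card_filter_not (s := (Finset.univ : Finset Ω))
      (fun ω => X ω ≤ s)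
    rw [Finset.card_univ] at this
    simp only [G, b, N]
    exact_mod_cast this
  have h3 : b * (s + V / s) ^ 2 ≤ N * (V + (V / s) ^ 2) := by
    calc b * (s + V / s) ^ 2
        ≤ ∑ ω ∈ Finset.univ.filter fun ω => ¬ X ω ≤ s, (X ω + V / s) ^ 2 := by
          rw [← nsmul_eq_mul]
          refine Finset.card_nsmul_le_sum _ _ _ fun ω hω => ?_
          have := not_le.1 (Finset.mem_filter.1 hω).2
          have : 0 < V / s := by positivity
          gcongr
      _ ≤ ∑ ω, (X ω + V / s) ^ 2 :=
          Finset.sum_le_sum_of_subset_of_nonneg (Finset.filter_subset _ _)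
            fun _ _ _ => sq_nonneg _
      _ = ∑ ω, X ω ^ 2 + 2 * (V / s) * ∑ ω, X ω + N * (V / s) ^ 2 := by
          simp_rw [add_sq, Finset.sum_add_distrib, Finset.mul_sum]
          simp only [Finset.sum_const, Finset.card_univ, nsmul_eq_mul, N]
          congr 2
          exact Finset.sum_congr rfl fun _ _ => by ring
      _ ≤ _ := by rw [h1]; linarith
  have h4 : (s + V / s) ^ 2 = (V + s ^ 2) ^ 2 / s ^ 2 := by field_simp; ring
  have h5 : V + (V / s) ^ 2 = V * (V + s ^ 2) / s ^ 2 := by field_simp; ring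
  rw [h4, h5, ← mul_div_assoc, ← mul_div_assoc, div_le_div_iff_of_pos_right (by positivity)] at h3
  have h6 : b * (V + s ^ 2) ≤ N * V := by
    have h7 : (0 : ℝ) < V + s ^ 2 := by positivity
    nlinarith
  rw [div_mul_eq_mul_div, div_le_iff₀ (by positivity)]
  nlinarith

lemma card_rSeq_le (n : ℕ) (hn : 1 ≤ n) (K : ℝ) (hK : 0 < K) :
    K ^ 2 / (1 + K ^ 2) * n.factorial ≤ ((Finset.univ.filter fun σ : Equiv.Perm (Fin n) =>
      (rSeq n σ : ℝ) - (n + 1) / 2 ≤ K * √n).card : ℝ) := by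
  have hn' : (0 : ℝ) < n := by exact_mod_cast hn
  have h := cantelli (fun σ : Equiv.Perm (Fin n) => (rSeq n σ : ℝ) - (n + 1) / 2) n (K * √n)
    hn' (by positivity) (sum_rSeq_dev n hn)
    (by simpa [Fintype.card_perm] using sum_rSeq_dev_sq_le n hn)
  rw [Fintype.card_perm, Fintype.card_fin, mul_pow, Real.sq_sqrt hn'.le] at h
  convert h using 2
  field_simp

lemma card_le_rSeq (n : ℕ) (hn : 1 ≤ n) (K : ℝ) (hK : 0 < K) :
    K ^ 2 / (1 + K ^ 2) * n.factorial ≤ ((Finset.univ.filter fun σ : Equiv.Perm (Fin n) =>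
      -((rSeq n σ : ℝ) - (n + 1) / 2) ≤ K * √n).card : ℝ) := by
  have hn' : (0 : ℝ) < n := by exact_mod_cast hn
  have h := cantelli (fun σ : Equiv.Perm (Fin n) => -((rSeq n σ : ℝ) - (n + 1) / 2)) n (K * √n)
    hn' (by positivity) (by rw [Finset.sum_neg_distrib, sum_rSeq_dev n hn, neg_zero])
    (by simpa only [neg_sq, Fintype.card_perm, Fintype.card_fin] using sum_rSeq_dev_sq_le n hn)
  rw [Fintype.card_perm, Fintype.card_fin, mul_pow, Real.sq_sqrt hn'.le] at h
  convert h using 2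
  field_simp

lemma one_add_le_exp_sub_sq (x : ℝ) (h1 : -1 ≤ x) (h2 : x ≤ 1) :
    1 + x ≤ Real.exp (x - x ^ 2 / 4) := by
  rcases le_total 0 x with h | h
  · refine le_trans ?_ (Real.quadratic_le_exp_of_nonneg (by nlinarith))
    nlinarith [mul_nonneg h h, mul_nonneg (mul_nonneg h h) (sub_nonneg.2 h2)]
  · have h3 : Real.exp (x - x ^ 2 / 4) = Real.exp ((x - x ^ 2 / 4) / 2) ^ 2 := by
      rw [← Real.exp_nat_mul]; congr 1; push_cast; ring
    rw [h3]
    have h4 := Real.add_one_le_exp ((x - x ^ 2 / 4) / 2)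
    have h5 : 0 ≤ (x - x ^ 2 / 4) / 2 + 1 := by nlinarith
    refine le_trans ?_ (pow_le_pow_left₀ h5 h4 2)
    nlinarith [mul_nonneg (mul_nonneg (neg_nonneg.2 h) (neg_nonneg.2 h)) (neg_nonneg.2 h),
      sq_nonneg (x ^ 2)]

lemma exp_sub_sq_le_one_add (x : ℝ) (h1 : -(1 / 2) ≤ x) : Real.exp (x - x ^ 2) ≤ 1 + x := by
  have key : 1 ≤ (1 + x) * Real.exp (x ^ 2 - x) := by
    rcases le_total 0 x with h | h
    · have h2 := Real.add_one_le_exp (x ^ 2 - x)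
      have h3 : (1 + x) * (x ^ 2 - x + 1) ≤ (1 + x) * Real.exp (x ^ 2 - x) := by gcongr
      nlinarith [pow_nonneg h 3]
    · have h2 := Real.quadratic_le_exp_of_nonneg (x := x ^ 2 - x) (by nlinarith)
      have h3 : (1 + x) * (1 + (x ^ 2 - x) + (x ^ 2 - x) ^ 2 / 2) ≤
          (1 + x) * Real.exp (x ^ 2 - x) := by
        have : 0 ≤ 1 + x := by linarith
        gcongr
      have h4 : 0 ≤ x + (1 + x) * (1 - x) ^ 2 / 2 := by nlinarith
      nlinarith [mul_nonneg (sq_nonneg x) h4]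
  have h5 : Real.exp (x - x ^ 2) * Real.exp (x ^ 2 - x) = 1 := by
    rw [← Real.exp_add]; simp
  nlinarith [Real.exp_pos (x ^ 2 - x), Real.exp_pos (x - x ^ 2)]

lemma rSeq_le (n : ℕ) (hn : 1 ≤ n) (σ : Equiv.Perm (Fin n)) : rSeq n σ ≤ n := by
  rw [rSeq_eq_desCount]
  have := desCount_le σ⁻¹ (n - 1)
  omega

lemma one_le_rSeq (n : ℕ) (σ : Equiv.Perm (Fin n)) : 1 ≤ rSeq n σ := Nat.le_add_right _ _

lemma factorial_mul_Qs (n M : ℕ) (hn : 1 ≤ n) (hM : n ≤ M) (σ : Equiv.Perm (Fin n)) :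
    n.factorial * Qs n M σ = ∏ i ∈ Finset.range n, (1 + ((i : ℝ) + 1 - rSeq n σ) / M) := by
  have hr := (rSeq_le n hn σ).trans hM
  have hM0 : (M : ℝ) ≠ 0 := by
    have : 0 < M := by omega
    positivity
  have h1 : n + M - rSeq n σ = (M - rSeq n σ) + n := by omega
  have h2 : (n.factorial : ℝ) * ((M - rSeq n σ + n).choose n : ℝ) =
      ∏ i ∈ Finset.range n, ((M : ℝ) - rSeq n σ + 1 + i) := by
    rw [← Nat.cast_mul, ← Nat.ascFactorial_eq_factorial_mul_choose, Nat.ascFactorial_eq_prod_range]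
    push_cast [Nat.cast_sub hr]
    rfl
  have h3 : ((M : ℝ) ^ n)⁻¹ = ∏ _i ∈ Finset.range n, (M : ℝ)⁻¹ := by simp
  rw [Qs, h1, mul_left_comm, h2, h3, ← Finset.prod_mul_distrib]
  refine Finset.prod_congr rfl fun i _ => ?_
  field_simp
  ring

lemma sum_range_sub (n : ℕ) (r : ℝ) :
    ∑ i ∈ Finset.range n, ((i : ℝ) + 1 - r) = -(n * (r - (n + 1) / 2)) := by
  induction n with
  | zero => simp
  | succ n ih => rw [Finset.sum_range_succ, ih]; push_cast; ring

lemma sum_range_sub_sq (n : ℕ) (r : ℝ) : ∑ i ∈ Finset.range n, ((i : ℝ) + 1 - r) ^ 2 =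
    n * ((n : ℝ) ^ 2 - 1) / 12 + n * (r - (n + 1) / 2) ^ 2 := by
  induction n with
  | zero => simp
  | succ n ih => rw [Finset.sum_range_succ, ih]; push_cast; ring

lemma sq_mul_sqrt_div (n M : ℝ) (hn : 0 ≤ n) : (n * √n / M) ^ 2 = n ^ 3 / M ^ 2 := by
  rw [div_pow, mul_pow, Real.sq_sqrt hn]
  ring

lemma factorial_mul_Qs_le (n M : ℕ) (hn : 2 ≤ n) (hM : n ≤ M) (K : ℝ)
    (σ : Equiv.Perm (Fin n)) (hσ : -((rSeq n σ : ℝ) - (n + 1) / 2) ≤ K * √n) :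
    n.factorial * Qs n M σ ≤ Real.exp (K * (n * √n / M) - (n * √n / M) ^ 2 / 96) := by
  have hn1 : 1 ≤ n := by omega
  have hr1 : (1 : ℝ) ≤ rSeq n σ := by exact_mod_cast one_le_rSeq n σ
  have hrn : (rSeq n σ : ℝ) ≤ n := by exact_mod_cast rSeq_le n hn1 σ
  have hn' : (2 : ℝ) ≤ n := by exact_mod_cast hn
  have hMn : (n : ℝ) ≤ M := by exact_mod_cast hM
  have hM0 : (0 : ℝ) < M := by linarith
  rw [factorial_mul_Qs n M hn1 hM, sq_mul_sqrt_div _ _ (by positivity)]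
  calc ∏ i ∈ Finset.range n, (1 + ((i : ℝ) + 1 - rSeq n σ) / M)
      ≤ ∏ i ∈ Finset.range n, Real.exp (((i : ℝ) + 1 - rSeq n σ) / M -
          (((i : ℝ) + 1 - rSeq n σ) / M) ^ 2 / 4) := by
        have hx : ∀ i ∈ Finset.range n, -1 ≤ ((i : ℝ) + 1 - rSeq n σ) / M ∧
            ((i : ℝ) + 1 - rSeq n σ) / M ≤ 1 := by
          intro i hi
          have hi1 : (i : ℝ) + 1 ≤ n := by exact_mod_cast Finset.mem_range.1 hi
          have hi0 : (0 : ℝ) ≤ i := by positivity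
          rw [le_div_iff₀ hM0, div_le_iff₀ hM0]
          constructor <;> linarith
        refine Finset.prod_le_prod (fun i hi => ?_) fun i hi => ?_
        · linarith [(hx i hi).1]
        · exact one_add_le_exp_sub_sq _ (hx i hi).1 (hx i hi).2
    _ = Real.exp (-(n * ((rSeq n σ : ℝ) - (n + 1) / 2)) / M -
          (n * ((n : ℝ) ^ 2 - 1) / 12 + n * ((rSeq n σ : ℝ) - (n + 1) / 2) ^ 2) / (4 * M ^ 2)) := by
        rw [← Real.exp_sum, Finset.sum_sub_distrib, ← Finset.sum_div, sum_range_sub,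
          ← Finset.sum_div]
        simp_rw [div_pow]
        rw [← Finset.sum_div, sum_range_sub_sq]
        congr 2
        field_simp
    _ ≤ _ := by
        refine Real.exp_le_exp.2 (sub_le_sub ?_ ?_)
        · rw [← mul_div_assoc]
          refine div_le_div_of_nonneg_right ?_ hM0.le
          nlinarith
        · rw [div_div, mul_comm ((M : ℝ) ^ 2) 96]
          rw [div_le_div_iff₀ (by positivity) (by positivity)]
          have h1 : (n : ℝ) ^ 3 ≤ 24 * (n * ((n : ℝ) ^ 2 - 1) / 12 +
              n * ((rSeq n σ : ℝ) - (n + 1) / 2) ^ 2) := by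
            have h2 : 0 ≤ (n : ℝ) * ((rSeq n σ : ℝ) - (n + 1) / 2) ^ 2 := by positivity
            nlinarith [mul_nonneg (by linarith : (0 : ℝ) ≤ n)
              (by nlinarith : (0 : ℝ) ≤ (n : ℝ) ^ 2 - 2)]
          nlinarith [mul_le_mul_of_nonneg_right h1 (by positivity : (0 : ℝ) ≤ 4 * (M : ℝ) ^ 2)]

lemma le_factorial_mul_Qs (n M : ℕ) (hn : 1 ≤ n) (hM : 2 * n ≤ M) (K : ℝ)
    (σ : Equiv.Perm (Fin n)) (hσ : (rSeq n σ : ℝ) - (n + 1) / 2 ≤ K * √n) :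
    Real.exp (-(K * (n * √n / M)) - (n * √n / M) ^ 2) ≤ n.factorial * Qs n M σ := by
  have hr1 : (1 : ℝ) ≤ rSeq n σ := by exact_mod_cast one_le_rSeq n σ
  have hrn : (rSeq n σ : ℝ) ≤ n := by exact_mod_cast rSeq_le n hn σ
  have hn' : (1 : ℝ) ≤ n := by exact_mod_cast hn
  have hMn : 2 * (n : ℝ) ≤ M := by exact_mod_cast hM
  have hM0 : (0 : ℝ) < M := by linarith
  rw [factorial_mul_Qs n M hn (by omega), sq_mul_sqrt_div _ _ (by positivity)]
  have hx : ∀ i ∈ Finset.range n, |(i : ℝ) + 1 - rSeq n σ| ≤ n := by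
    intro i hi
    have hi1 : (i : ℝ) + 1 ≤ n := by exact_mod_cast Finset.mem_range.1 hi
    have hi0 : (0 : ℝ) ≤ i := by positivity
    rw [abs_le]
    constructor <;> linarith
  calc Real.exp (-(K * (n * √n / M)) - (n : ℝ) ^ 3 / M ^ 2)
      ≤ Real.exp (∑ i ∈ Finset.range n, (((i : ℝ) + 1 - rSeq n σ) / M -
          (((i : ℝ) + 1 - rSeq n σ) / M) ^ 2)) := by
        rw [Finset.sum_sub_distrib, ← Finset.sum_div, sum_range_sub]
        simp_rw [div_pow]
        rw [← Finset.sum_div]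
        gcongr
        · rw [← mul_div_assoc, ← neg_div]
          refine div_le_div_of_nonneg_right ?_ hM0.le
          nlinarith
        · refine (Finset.sum_le_card_nsmul _ _ ((n : ℝ) ^ 2) fun i hi => ?_).trans (le_of_eq ?_)
          · rw [← sq_abs]
            exact pow_le_pow_left₀ (abs_nonneg _) (hx i hi) 2
          · rw [Finset.card_range, nsmul_eq_mul]
            ring
    _ = ∏ i ∈ Finset.range n, Real.exp (((i : ℝ) + 1 - rSeq n σ) / M -
          (((i : ℝ) + 1 - rSeq n σ) / M) ^ 2) := Real.exp_sum _ _
    _ ≤ _ := by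
        refine Finset.prod_le_prod (fun i _ => (Real.exp_pos _).le) fun i hi => ?_
        refine exp_sub_sq_le_one_add _ ?_
        rw [le_div_iff₀ hM0]
        linarith [(abs_le.1 (hx i hi)).1]

lemma tv_nonneg (n : ℕ) (μ ν : Equiv.Perm (Fin n) → ℝ) : 0 ≤ tv n μ ν := by
  unfold tv
  positivity

lemma sum_Us (n : ℕ) : ∑ σ, Us n σ = 1 := by
  simp [Us, Fintype.card_perm, Nat.factorial_ne_zero]

lemma tv_eq_one_sub_sum_min (n : ℕ) (μ ν : Equiv.Perm (Fin n) → ℝ) (hμ : ∑ σ, μ σ = 1)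
    (hν : ∑ σ, ν σ = 1) : tv n μ ν = 1 - ∑ σ, min (μ σ) (ν σ) := by
  have h : ∀ σ, |μ σ - ν σ| = μ σ + ν σ - 2 * min (μ σ) (ν σ) := by
    intro σ
    rcases le_total (μ σ) (ν σ) with h | h
    · rw [min_eq_left h, abs_of_nonpos (by linarith)]; ring
    · rw [min_eq_right h, abs_of_nonneg (by linarith)]; ring
  simp_rw [tv, h, Finset.sum_sub_distrib, Finset.sum_add_distrib, hμ, hν, ← Finset.mul_sum]
  ring

lemma tv_Qs_le_one (n m : ℕ) (hm : 0 < m) : tv n (Qs n m) (Us n) ≤ 1 := by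
  rw [tv_eq_one_sub_sum_min n _ _ (sum_Qs n m hm) (sum_Us n)]
  have : 0 ≤ ∑ σ, min (Qs n m σ) (Us n σ) :=
    Finset.sum_nonneg fun σ _ => le_min (Qs_nonneg n m σ) (by unfold Us; positivity)
  linarith

lemma le_tv_Qs (n M : ℕ) (hn : 2 ≤ n) (hM : n ≤ M) (K : ℝ) (hK : 0 < K) :
    K ^ 2 / (1 + K ^ 2) *
      (1 - Real.exp (K * (n * √n / M) - (n * √n / M) ^ 2 / 96)) ≤ tv n (Qs n M) (Us n) := by
  set e := Real.exp (K * (n * √n / M) - (n * √n / M) ^ 2 / 96) with he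
  rcases le_or_gt 1 e with h1 | h1
  · exact (mul_nonpos_of_nonneg_of_nonpos (by positivity) (by linarith)).trans (tv_nonneg _ _ _)
  have hf : (0 : ℝ) < n.factorial := by exact_mod_cast n.factorial_pos
  have htv : tv n (Qs n M) (Us n) = ∑ σ, (Us n σ - min (Qs n M σ) (Us n σ)) := by
    rw [tv_eq_one_sub_sum_min n _ _ (sum_Qs n M (by omega)) (sum_Us n), Finset.sum_sub_distrib,
      sum_Us n]
  rw [htv]
  set G := Finset.univ.filter fun σ : Equiv.Perm (Fin n) =>
      -((rSeq n σ : ℝ) - (n + 1) / 2) ≤ K * √n with hG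
  calc K ^ 2 / (1 + K ^ 2) * (1 - e)
      = (K ^ 2 / (1 + K ^ 2) * n.factorial) * ((1 - e) / n.factorial) := by field_simp
    _ ≤ G.card * ((1 - e) / n.factorial) :=
        mul_le_mul_of_nonneg_right (card_le_rSeq n (by omega) K hK)
          (div_nonneg (by linarith) hf.le)
    _ ≤ ∑ σ ∈ G, (Us n σ - min (Qs n M σ) (Us n σ)) := by
        rw [← nsmul_eq_mul]
        refine Finset.card_nsmul_le_sum _ _ _ fun σ hσ => ?_
        have h2 := factorial_mul_Qs_le n M hn hM K σ (Finset.mem_filter.1 hσ).2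
        have h3 : Qs n M σ ≤ e / n.factorial := by
          rw [le_div_iff₀ hf]
          linarith
        have h4 : Us n σ = 1 / n.factorial := by simp [Us]
        rw [sub_div, h4]
        linarith [min_le_left (Qs n M σ) (1 / n.factorial)]
    _ ≤ ∑ σ, (Us n σ - min (Qs n M σ) (Us n σ)) :=
        Finset.sum_le_sum_of_subset_of_nonneg (Finset.filter_subset _ _)
          fun σ _ _ => sub_nonneg.2 (min_le_right _ _)

lemma tv_Qs_le (n M : ℕ) (hn : 1 ≤ n) (hM : 2 * n ≤ M) (K : ℝ) (hK : 0 < K) :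
    tv n (Qs n M) (Us n) ≤
      1 - K ^ 2 / (1 + K ^ 2) * Real.exp (-(K * (n * √n / M)) - (n * √n / M) ^ 2) := by
  set e := Real.exp (-(K * (n * √n / M)) - (n * √n / M) ^ 2) with he
  have he1 : e ≤ 1 := by
    rw [he, Real.exp_le_one_iff]
    have h1 : 0 ≤ K * (n * √n / M) := by positivity
    nlinarith [sq_nonneg ((n : ℝ) * √n / M)]
  have hf : (0 : ℝ) < n.factorial := by exact_mod_cast n.factorial_pos
  rw [tv_eq_one_sub_sum_min n _ _ (sum_Qs n M (by omega)) (sum_Us n)]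
  set G := Finset.univ.filter fun σ : Equiv.Perm (Fin n) =>
      (rSeq n σ : ℝ) - (n + 1) / 2 ≤ K * √n with hG
  refine sub_le_sub_left ?_ 1
  calc K ^ 2 / (1 + K ^ 2) * e
      = (K ^ 2 / (1 + K ^ 2) * n.factorial) * (e / n.factorial) := by field_simp
    _ ≤ G.card * (e / n.factorial) :=
        mul_le_mul_of_nonneg_right (card_rSeq_le n hn K hK) (by positivity)
    _ ≤ ∑ σ ∈ G, min (Qs n M σ) (Us n σ) := by
        rw [← nsmul_eq_mul]
        refine Finset.card_nsmul_le_sum _ _ _ fun σ hσ => ?_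
        have h2 := le_factorial_mul_Qs n M hn hM K σ (Finset.mem_filter.1 hσ).2
        refine le_min ?_ ?_
        · rw [div_le_iff₀ hf]
          linarith
        · rw [Us, ← one_div]
          gcongr
    _ ≤ ∑ σ, min (Qs n M σ) (Us n σ) :=
        Finset.sum_le_sum_of_subset_of_nonneg (Finset.filter_subset _ _)
          fun σ _ _ => le_min (Qs_nonneg n M σ) (by unfold Us; positivity)

/-- The cutoff time `3 log n / (2 log N)`. -/
def cutoffTime (n N : ℕ) : ℝ := 3 * Real.log n / (2 * Real.log N)

lemma mul_sqrt_div_pow (n N : ℕ) (hn : 1 ≤ n) (hN : 2 ≤ N) (j : ℤ) (hj : 0 ≤ j) :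
    (n : ℝ) * √n / ((N ^ j.toNat : ℕ) : ℝ) = Real.exp ((cutoffTime n N - j) * Real.log N) := by
  have hn' : (0 : ℝ) < n := by exact_mod_cast hn
  have hN' : (0 : ℝ) < N := by positivity
  have hl : 0 < Real.log N := Real.log_pos (by exact_mod_cast hN)
  have h1 : Real.exp (cutoffTime n N * Real.log N) = n * √n := by
    rw [cutoffTime, show 3 * Real.log n / (2 * Real.log N) * Real.log N =
      Real.log n + Real.log n / 2 by field_simp; ring, Real.exp_add, Real.exp_log hn',
      ← Real.log_sqrt hn'.le, Real.exp_log (Real.sqrt_pos.2 hn')]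
  have h2 : Real.exp (j * Real.log N) = ((N ^ j.toNat : ℕ) : ℝ) := by
    have h3 : (j : ℝ) = (j.toNat : ℝ) := by exact_mod_cast (Int.toNat_of_nonneg hj).symm
    rw [h3, Real.exp_nat_mul, Real.exp_log hN', Nat.cast_pow]
  rw [sub_mul, Real.exp_sub, h1, h2]

lemma tendsto_cutoffTime (m : ℕ → ℕ) (hm : ∀ n, 2 ≤ m n) (B : ℕ) (hB : ∀ n, m n ≤ B) :
    Tendsto (fun n => cutoffTime n (m n)) atTop atTop := by
  have hB2 : 2 ≤ B := (hm 0).trans (hB 0)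
  have hlB : 0 < Real.log B := Real.log_pos (by exact_mod_cast hB2)
  have h1 : Tendsto (fun n : ℕ => Real.log n * (3 / (2 * Real.log B))) atTop atTop :=
    (Real.tendsto_log_atTop.comp tendsto_natCast_atTop_atTop).atTop_mul_const (by positivity)
  refine tendsto_atTop_mono (fun n => ?_) h1
  have hl : 0 < Real.log (m n) := Real.log_pos (by exact_mod_cast hm n)
  have hle : Real.log (m n) ≤ Real.log B :=
    Real.log_le_log (by have := hm n; positivity) (by exact_mod_cast hB n)
  have hn : 0 ≤ Real.log n := Real.log_natCast_nonneg n
  rw [cutoffTime, mul_div_assoc', mul_comm (Real.log n)]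
  gcongr

lemma eventually_near_cutoff (m : ℕ → ℕ) (hm : ∀ n, 2 ≤ m n) (B : ℕ) (hB : ∀ n, m n ≤ B)
    (C : ℝ) : ∀ᶠ n : ℕ in atTop, ∀ j : ℤ, |(j : ℝ) - cutoffTime n (m n)| ≤ C →
      2 ≤ n ∧ 2 * n ≤ m n ^ j.toNat ∧
      (n : ℝ) * √n / ((m n ^ j.toNat : ℕ) : ℝ) =
        Real.exp ((cutoffTime n (m n) - j) * Real.log (m n)) := by
  have hs : Tendsto (fun n : ℕ => √(n : ℝ)) atTop atTop :=
    Real.tendsto_sqrt_atTop.comp tendsto_natCast_atTop_atTop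
  filter_upwards [eventually_ge_atTop 2, (tendsto_cutoffTime m hm B hB).eventually_ge_atTop C,
    hs.eventually_ge_atTop (2 * Real.exp (C * Real.log B))] with n hn ht hsq j hj
  obtain ⟨hj1, hj2⟩ := abs_le.1 hj
  have hj0 : 0 ≤ j := by
    have : (0 : ℝ) ≤ j := by linarith
    exact_mod_cast this
  have hu := mul_sqrt_div_pow n (m n) (by omega) (hm n) j hj0
  refine ⟨hn, ?_, hu⟩
  have hl : 0 < Real.log (m n) := Real.log_pos (by exact_mod_cast hm n)
  have hle : Real.log (m n) ≤ Real.log B :=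
    Real.log_le_log (by have := hm n; positivity) (by exact_mod_cast hB n)
  have hC : 0 ≤ C := (abs_nonneg _).trans hj
  have hub : Real.exp ((cutoffTime n (m n) - j) * Real.log (m n)) ≤
      Real.exp (C * Real.log B) := by
    refine Real.exp_le_exp.2 ?_
    calc (cutoffTime n (m n) - j) * Real.log (m n) ≤ C * Real.log (m n) := by gcongr; linarith
      _ ≤ C * Real.log B := by gcongr
  have hM : (0 : ℝ) < ((m n ^ j.toNat : ℕ) : ℝ) := by
    have := hm n
    positivity
  rw [← hu, div_le_iff₀ hM] at hub
  have hn' : (0 : ℝ) < n := by positivity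
  have hW := Real.exp_pos (C * Real.log B)
  have h1 : (2 * n : ℝ) * Real.exp (C * Real.log B) ≤
      ((m n ^ j.toNat : ℕ) : ℝ) * Real.exp (C * Real.log B) := by nlinarith
  have h2 := le_of_mul_le_mul_right h1 hW
  exact_mod_cast h2

lemma tv_Qs_le_of_near (m : ℕ → ℕ) (hm : ∀ n, 2 ≤ m n) (n : ℕ) (j : ℤ) (K u : ℝ) (hK : 0 < K)
    (hn : 1 ≤ n) (hM : 2 * n ≤ m n ^ j.toNat)
    (hu : (n : ℝ) * √n / ((m n ^ j.toNat : ℕ) : ℝ) ≤ u) :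
    tv n (iterConv n (Qs n (m n)) j.toNat) (Us n) ≤
      1 - K ^ 2 / (1 + K ^ 2) * Real.exp (-(K * u) - u ^ 2) := by
  have := hm n
  rw [iterConv_Qs n (m n)]
  refine (tv_Qs_le n _ hn hM K hK).trans ?_
  gcongr

lemma le_tv_Qs_of_near (m : ℕ → ℕ) (n : ℕ) (j : ℤ) (K : ℝ) (hK : 0 < K)
    (hn : 2 ≤ n) (hM : 2 * n ≤ m n ^ j.toNat)
    (hu : 192 * K ≤ (n : ℝ) * √n / ((m n ^ j.toNat : ℕ) : ℝ)) :
    K ^ 2 / (1 + K ^ 2) * (1 - Real.exp (-(192 * K ^ 2))) ≤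
      tv n (iterConv n (Qs n (m n)) j.toNat) (Us n) := by
  rw [iterConv_Qs n (m n)]
  refine le_trans ?_ (le_tv_Qs n _ hn (by omega) K hK)
  gcongr
  nlinarith

lemma limsup_nonneg_of_nonneg_le_one {f : ℕ → ℝ} (h0 : ∀ n, 0 ≤ f n) (h1 : ∀ n, f n ≤ 1) :
    0 ≤ limsup f atTop :=
  le_limsup_of_frequently_le (Frequently.of_forall h0) (isBoundedUnder_of ⟨1, h1⟩)

lemma limsup_le_of_eventually {f : ℕ → ℝ} (h0 : ∀ n, 0 ≤ f n) {a : ℝ}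
    (h : ∀ᶠ n in atTop, f n ≤ a) : limsup f atTop ≤ a :=
  limsup_le_of_le (isBoundedUnder_of (r := (· ≥ ·)) ⟨0, h0⟩).isCoboundedUnder_le h

lemma le_liminf_of_eventually {f : ℕ → ℝ} (h1 : ∀ n, f n ≤ 1) {a : ℝ}
    (h : ∀ᶠ n in atTop, a ≤ f n) : a ≤ liminf f atTop :=
  le_liminf_of_le (isBoundedUnder_of (r := (· ≤ ·)) ⟨1, h1⟩).isCoboundedUnder_ge h

lemma liminf_le_one_of_nonneg_le_one {f : ℕ → ℝ} (h0 : ∀ n, 0 ≤ f n) (h1 : ∀ n, f n ≤ 1) :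
    liminf f atTop ≤ 1 :=
  liminf_le_of_frequently_le (Frequently.of_forall h1) (isBoundedUnder_of ⟨0, h0⟩)

lemma tv_iterConv_le_one (n m k : ℕ) (hm : 0 < m) : tv n (iterConv n (Qs n m) k) (Us n) ≤ 1 := by
  rw [iterConv_Qs n m]
  exact tv_Qs_le_one n _ (Nat.pow_pos hm)

lemma tendsto_limsup_after_cutoff (m : ℕ → ℕ) (hm : ∀ n, 2 ≤ m n) (B : ℕ) (hB : ∀ n, m n ≤ B) :
    Tendsto (fun c : ℝ => limsup (fun n : ℕ =>
      tv n (iterConv n (Qs n (m n)) (⌈cutoffTime n (m n) + c⌉).toNat) (Us n)) atTop)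
      atTop (nhds 0) := by
  have h1 : ∀ c n, tv n (iterConv n (Qs n (m n)) (⌈cutoffTime n (m n) + c⌉).toNat) (Us n) ≤ 1 :=
    fun c n => tv_iterConv_le_one _ _ _ (by have := hm n; omega)
  let Φ : ℝ → ℝ := fun v => 1 - 1 / (1 + v ^ 2) * Real.exp (-v - (v ^ 2) ^ 2)
  let v : ℝ → ℝ := fun c => Real.exp (-(c * (Real.log 2 / 2)))
  have hl2 : 0 < Real.log 2 := Real.log_pos (by norm_num)
  have hv : Tendsto v atTop (nhds 0) :=
    Real.tendsto_exp_neg_atTop_nhds_zero.comp (tendsto_id.atTop_mul_const (by positivity))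
  have hΦ : Continuous Φ := by
    refine continuous_const.sub (Continuous.mul (continuous_const.div (by fun_prop) ?_)
      (by fun_prop))
    intro x
    positivity
  have hlim : Tendsto (fun c => Φ (v c)) atTop (nhds 0) := by
    have := (hΦ.tendsto 0).comp hv
    simpa [Φ, Function.comp_def] using this
  refine tendsto_of_tendsto_of_tendsto_of_le_of_le' tendsto_const_nhds hlim
    (Eventually.of_forall fun c =>
      limsup_nonneg_of_nonneg_le_one (fun n => tv_nonneg _ _ _) (h1 c)) ?_
  filter_upwards [eventually_ge_atTop 0] with c hc
  refine limsup_le_of_eventually (fun n => tv_nonneg _ _ _) ?_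
  filter_upwards [eventually_near_cutoff m hm B hB (c + 1)] with n hn
  have hj1 := Int.le_ceil (cutoffTime n (m n) + c)
  have hj2 := Int.ceil_lt_add_one (cutoffTime n (m n) + c)
  obtain ⟨hn2, hM, hu⟩ := hn ⌈cutoffTime n (m n) + c⌉ (by rw [abs_le]; constructor <;> linarith)
  have hvpos : 0 < v c := Real.exp_pos _
  have hlm : Real.log 2 ≤ Real.log (m n) :=
    Real.log_le_log (by norm_num) (by exact_mod_cast hm n)
  have hu' : (n : ℝ) * √n / ((m n ^ ⌈cutoffTime n (m n) + c⌉.toNat : ℕ) : ℝ) ≤ v c ^ 2 := by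
    rw [hu, ← Real.exp_nat_mul]
    refine Real.exp_le_exp.2 ?_
    push_cast
    nlinarith
  refine (tv_Qs_le_of_near m hm n _ (v c)⁻¹ _ (by positivity) (by omega) hM hu').trans
    (le_of_eq ?_)
  simp only [Φ]
  congr 2
  · field_simp
    ring
  · congr 2
    field_simp

lemma tendsto_liminf_before_cutoff (m : ℕ → ℕ) (hm : ∀ n, 2 ≤ m n) (B : ℕ)
    (hB : ∀ n, m n ≤ B) :
    Tendsto (fun c : ℝ => liminf (fun n : ℕ =>
      tv n (iterConv n (Qs n (m n)) (⌊cutoffTime n (m n) - c⌋).toNat) (Us n)) atTop)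
      atTop (nhds 1) := by
  have h1 : ∀ c n, tv n (iterConv n (Qs n (m n)) (⌊cutoffTime n (m n) - c⌋).toNat) (Us n) ≤ 1 :=
    fun c n => tv_iterConv_le_one _ _ _ (by have := hm n; omega)
  let K : ℝ → ℝ := fun c => Real.exp (c * Real.log 2) / 192
  have hl2 : 0 < Real.log 2 := Real.log_pos (by norm_num)
  have hK : Tendsto K atTop atTop :=
    (Real.tendsto_exp_atTop.comp (tendsto_id.atTop_mul_const hl2)).atTop_div_const (by norm_num)
  have hK2 : Tendsto (fun c => K c ^ 2) atTop atTop := (tendsto_pow_atTop two_ne_zero).comp hK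
  have hlim : Tendsto (fun c => K c ^ 2 / (1 + K c ^ 2) * (1 - Real.exp (-(192 * K c ^ 2))))
      atTop (nhds 1) := by
    have e1 : Tendsto (fun c => 1 - (1 + K c ^ 2)⁻¹) atTop (nhds (1 - 0)) :=
      tendsto_const_nhds.sub (tendsto_inv_atTop_zero.comp (tendsto_atTop_add_const_left _ 1 hK2))
    have e2 : Tendsto (fun c => 1 - Real.exp (-(192 * K c ^ 2))) atTop (nhds (1 - 0)) :=
      tendsto_const_nhds.sub (Real.tendsto_exp_neg_atTop_nhds_zero.comp
        (hK2.const_mul_atTop (by norm_num)))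
    have e3 := e1.mul e2
    simp only [sub_zero, mul_one] at e3
    refine e3.congr fun c => ?_
    congr 1
    have : 1 + K c ^ 2 ≠ 0 := by positivity
    field_simp
    ring
  refine tendsto_of_tendsto_of_tendsto_of_le_of_le' hlim tendsto_const_nhds ?_
    (Eventually.of_forall fun c =>
      liminf_le_one_of_nonneg_le_one (fun n => tv_nonneg _ _ _) (h1 c))
  filter_upwards [eventually_ge_atTop 0] with c hc
  refine le_liminf_of_eventually (h1 c) ?_
  filter_upwards [eventually_near_cutoff m hm B hB (c + 1)] with n hn
  have hj1 := Int.floor_le (cutoffTime n (m n) - c)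
  have hj2 := Int.lt_floor_add_one (cutoffTime n (m n) - c)
  obtain ⟨hn2, hM, hu⟩ := hn ⌊cutoffTime n (m n) - c⌋ (by rw [abs_le]; constructor <;> linarith)
  have hlm : Real.log 2 ≤ Real.log (m n) :=
    Real.log_le_log (by norm_num) (by exact_mod_cast hm n)
  refine le_tv_Qs_of_near m n _ (K c) (by positivity) hn2 hM ?_
  rw [hu, mul_div_cancel₀ _ (by norm_num)]
  refine Real.exp_le_exp.2 ?_
  nlinarith

lemma exists_bounds_near_cutoff (m : ℕ → ℕ) (hm : ∀ n, 2 ≤ m n) (B : ℕ) (hB : ∀ n, m n ≤ B)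
    (C : ℝ) : ∃ a b : ℝ, 0 < a ∧ b < 1 ∧ ∀ᶠ n : ℕ in atTop, ∀ j : ℤ,
      |(j : ℝ) - cutoffTime n (m n)| ≤ C →
        a ≤ tv n (iterConv n (Qs n (m n)) j.toNat) (Us n) ∧
        tv n (iterConv n (Qs n (m n)) j.toNat) (Us n) ≤ b := by
  let W := Real.exp (C * Real.log B)
  let K := Real.exp (-(C * Real.log B)) / 192
  have hK : 0 < K := by positivity
  refine ⟨K ^ 2 / (1 + K ^ 2) * (1 - Real.exp (-(192 * K ^ 2))),
    1 - 1 ^ 2 / (1 + 1 ^ 2) * Real.exp (-(1 * W) - W ^ 2), ?_, ?_, ?_⟩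
  · have : Real.exp (-(192 * K ^ 2)) < 1 := by
      rw [Real.exp_lt_one_iff]
      have : 0 < K ^ 2 := by positivity
      linarith
    have : 0 < 1 - Real.exp (-(192 * K ^ 2)) := by linarith
    positivity
  · have := Real.exp_pos (-(1 * W) - W ^ 2)
    linarith
  filter_upwards [eventually_near_cutoff m hm B hB C] with n hn j hj
  obtain ⟨hn2, hM, hu⟩ := hn j hj
  obtain ⟨hj1, hj2⟩ := abs_le.1 hj
  have hC : 0 ≤ C := (abs_nonneg _).trans hj
  have hl : 0 < Real.log (m n) := Real.log_pos (by exact_mod_cast hm n)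
  have hle : Real.log (m n) ≤ Real.log B :=
    Real.log_le_log (by have := hm n; positivity) (by exact_mod_cast hB n)
  have hCle : C * Real.log (m n) ≤ C * Real.log B := by gcongr
  refine ⟨le_tv_Qs_of_near m n j K hK hn2 hM ?_,
    tv_Qs_le_of_near m hm n j 1 W one_pos (by omega) hM ?_⟩
  · rw [hu, mul_div_cancel₀ _ (by norm_num)]
    refine Real.exp_le_exp.2 ?_
    nlinarith
  · rw [hu]
    refine Real.exp_le_exp.2 ?_
    nlinarith

lemma eventually_floor_curly_near (m : ℕ → ℕ) (hm : ∀ n, 2 ≤ m n) (B : ℕ)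
    (hB : ∀ n, m n ≤ B) (k : ℤ) : ∀ᶠ n : ℕ in atTop,
      |((⌊curly (cutoffTime n (m n))⌋ + k : ℤ) : ℝ) - cutoffTime n (m n)| ≤ |(k : ℝ)| + 1 / 2 := by
  filter_upwards [(tendsto_cutoffTime m hm B hB).eventually_ge_atTop (1 / 2)] with n hn
  rw [curly, if_neg (not_lt.2 hn), Int.floor_intCast, Int.cast_add]
  have h1 := abs_sub_round (cutoffTime n (m n))
  rw [abs_sub_comm] at h1
  calc |((round (cutoffTime n (m n)) : ℤ) : ℝ) + k - cutoffTime n (m n)|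
      = |(k : ℝ) + (((round (cutoffTime n (m n)) : ℤ) : ℝ) - cutoffTime n (m n))| := by
        congr 1; ring
    _ ≤ |(k : ℝ)| + 1 / 2 := (abs_add_le _ _).trans (by linarith)

/-- For a bounded sequence `m_n ≥ 2`: `t_n → ∞`, there is an optimal `(t_n, 1)` total
variation cutoff, and for each fixed integer `k` the distance after `{t_n} + k` shuffles
stays bounded away from `0` and `1`. -/
theorem bounded_m_shuffle_cutoff (m : ℕ → ℕ) (hm : ∀ n, 2 ≤ m n)
    (B : ℕ) (hB : ∀ n, m n ≤ B) :
    Filter.Tendsto (fun n : ℕ => 3 * Real.log n / (2 * Real.log (m n)))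
      Filter.atTop Filter.atTop ∧
    Filter.Tendsto (fun c : ℝ =>
      Filter.limsup (fun n : ℕ =>
        tv n (iterConv n (Qs n (m n))
          (⌈3 * Real.log n / (2 * Real.log (m n)) + c⌉).toNat) (Us n))
        Filter.atTop) Filter.atTop (nhds 0) ∧
    Filter.Tendsto (fun c : ℝ =>
      Filter.liminf (fun n : ℕ =>
        tv n (iterConv n (Qs n (m n))
          (⌊3 * Real.log n / (2 * Real.log (m n)) - c⌋).toNat) (Us n))
        Filter.atTop) Filter.atTop (nhds 1) ∧
    ∀ k : ℤ,
      0 < Filter.liminf (fun n : ℕ =>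
            tv n (iterConv n (Qs n (m n))
              ((⌊curly (3 * Real.log n / (2 * Real.log (m n)))⌋ + k).toNat) ) (Us n))
            Filter.atTop ∧
      Filter.liminf (fun n : ℕ =>
            tv n (iterConv n (Qs n (m n))
              ((⌊curly (3 * Real.log n / (2 * Real.log (m n)))⌋ + k).toNat)) (Us n))
            Filter.atTop ≤
        Filter.limsup (fun n : ℕ =>
            tv n (iterConv n (Qs n (m n))
              ((⌊curly (3 * Real.log n / (2 * Real.log (m n)))⌋ + k).toNat)) (Us n))
            Filter.atTop ∧
      Filter.limsup (fun n : ℕ =>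
            tv n (iterConv n (Qs n (m n))
              ((⌊curly (3 * Real.log n / (2 * Real.log (m n)))⌋ + k).toNat)) (Us n))
            Filter.atTop < 1 := by
  refine ⟨tendsto_cutoffTime m hm B hB, tendsto_limsup_after_cutoff m hm B hB,
    tendsto_liminf_before_cutoff m hm B hB, fun k => ?_⟩
  obtain ⟨a, b, ha, hb, h⟩ := exists_bounds_near_cutoff m hm B hB (|(k : ℝ)| + 1 / 2)
  have h0 : ∀ n, 0 ≤ tv n (iterConv n (Qs n (m n))
      (⌊curly (cutoffTime n (m n))⌋ + k).toNat) (Us n) := fun n => tv_nonneg _ _ _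
  have h1 : ∀ n, tv n (iterConv n (Qs n (m n))
      (⌊curly (cutoffTime n (m n))⌋ + k).toNat) (Us n) ≤ 1 :=
    fun n => tv_iterConv_le_one _ _ _ (by have := hm n; omega)
  have hc := eventually_floor_curly_near m hm B hB k
  refine ⟨ha.trans_le (le_liminf_of_eventually h1 ?_),
    liminf_le_limsup (isBoundedUnder_of ⟨1, h1⟩) (isBoundedUnder_of ⟨0, h0⟩),
    (limsup_le_of_eventually h0 ?_).trans_lt hb⟩
  · filter_upwards [h, hc] with n hn hn'
    exact (hn _ hn').1
  · filter_upwards [h, hc] with n hn hn'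
    exact (hn _ hn').2
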